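/- arXiv:1909.13796 — 3 statements merged into one kernel-verified Lean document; each statement's English description precedes it below -/
import Mathlib

section
/- Let C be a Weyl candidate tensor on Minkowski ℝ⁴ and let T be its Bel–Robinson tensor. Then T is fully symmetric in its four arguments, and every η-trace of T vanishes: Σ_{μ,ν} η^{μν} T(e_μ, e_ν, a, b) = 0 for all vectors a, b (and similarly for any other pair of slots, by the full symmetry). -/
open Finset

/-- Components `η^{μν} = diag(−1,1,1,1)` of the (inverse) Minkowski metric. -/
def ηinv (μ ν : Fin 4) : ℝ := if μ = ν then (if μ = 0 then -1 else 1) else 0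

/-- The Minkowski bilinear form on `ℝ⁴`: `η(u,v) = −u₀v₀ + u₁v₁ + u₂v₂ + u₃v₃`. -/
def mink (u v : Fin 4 → ℝ) : ℝ :=
  -(u 0 * v 0) + u 1 * v 1 + u 2 * v 2 + u 3 * v 3

/-- The standard basis `(e_μ)` of `ℝ⁴`. -/
def stdB (μ : Fin 4) : Fin 4 → ℝ := Pi.single μ 1

/-- The alternating symbol on four indices, with `ε₀₁₂₃ = 1`
(Vandermonde product formula). -/
noncomputable def eps (α β γ δ : Fin 4) : ℝ :=
  (((β : ℕ) - (α : ℕ) : ℝ) * ((γ : ℕ) - (α : ℕ) : ℝ) * ((δ : ℕ) - (α : ℕ) : ℝ) *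
   ((γ : ℕ) - (β : ℕ) : ℝ) * ((δ : ℕ) - (β : ℕ) : ℝ) * ((δ : ℕ) - (γ : ℕ) : ℝ)) / 12

/-- A 4-linear form on Minkowski `ℝ⁴`. -/
abbrev FourForm := MultilinearMap ℝ (fun _ : Fin 4 => (Fin 4 → ℝ)) ℝ

/-- Components `C_{αβγδ}` of a 4-linear form in the standard basis. -/
def comp (C : FourForm) (α β γ δ : Fin 4) : ℝ := C ![stdB α, stdB β, stdB γ, stdB δ]

/-- Components of the left dual `*C`:
`(*C)_{αβγδ} = (1/2) Σ ε_{αβμν} η^{μρ} η^{νσ} C_{ρσγδ}`. -/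
noncomputable def dualComp (C : FourForm) (α β γ δ : Fin 4) : ℝ :=
  (1 / 2) * ∑ μ : Fin 4, ∑ ν : Fin 4, ∑ ρ : Fin 4, ∑ σ : Fin 4,
    eps α β μ ν * ηinv μ ρ * ηinv ν σ * comp C ρ σ γ δ

/-- `C` is a Weyl candidate tensor: antisymmetric in the first and last pairs,
symmetric under interchange of pairs, satisfying the first Bianchi identity,
and traceless. -/
def IsWeylCandidate (C : FourForm) : Prop :=
  (∀ a b c d, C ![a, b, c, d] = -C ![b, a, c, d]) ∧
  (∀ a b c d, C ![a, b, c, d] = -C ![a, b, d, c]) ∧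
  (∀ a b c d, C ![a, b, c, d] = C ![c, d, a, b]) ∧
  (∀ a b c d, C ![a, b, c, d] + C ![a, c, d, b] + C ![a, d, b, c] = 0) ∧
  (∀ a b, ∑ μ : Fin 4, ∑ ν : Fin 4, ηinv μ ν * C ![stdB μ, a, stdB ν, b] = 0)

/-- Components of the Bel–Robinson tensor of `C`:
`T_{αβγδ} = Σ η^{μμ'} η^{νν'} ( C_{αμγν} C_{δν'βμ'} + (*C)_{αμγν} (*C)_{δν'βμ'} )`. -/
noncomputable def belRobinsonComp (C : FourForm) (α β γ δ : Fin 4) : ℝ :=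
  ∑ μ : Fin 4, ∑ ν : Fin 4, ∑ μ' : Fin 4, ∑ ν' : Fin 4,
    ηinv μ μ' * ηinv ν ν' *
      (comp C α μ γ ν * comp C δ ν' β μ' + dualComp C α μ γ ν * dualComp C δ ν' β μ')

/-- The Bel–Robinson tensor of `C` as a 4-linear form, evaluated on vectors. -/
noncomputable def belRobinson (C : FourForm) (a b c d : Fin 4 → ℝ) : ℝ :=
  ∑ α : Fin 4, ∑ β : Fin 4, ∑ γ : Fin 4, ∑ δ : Fin 4,
    a α * b β * c γ * d δ * belRobinsonComp C α β γ δ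

/-- The Hodge dual of a bivector on Minkowski `ℝ⁴`. -/
noncomputable def hodgeStar (F : Fin 4 → Fin 4 → ℝ) (α β : Fin 4) : ℝ :=
  (1 / 2) * ∑ μ : Fin 4, ∑ ν : Fin 4, eps α β μ ν * ηinv μ μ * ηinv ν ν * F μ ν

/-- The algebraic symmetries of a curvature tensor, for an array of components. -/
structure IsCurvatureLike (c : Fin 4 → Fin 4 → Fin 4 → Fin 4 → ℝ) : Prop where
  antisymm : ∀ α β γ δ, c α β γ δ = -c β α γ δ
  pair_symm : ∀ α β γ δ, c α β γ δ = c γ δ α β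
  bianchi : ∀ α β γ δ, c α β γ δ + c α γ δ β + c α δ β γ = 0

theorem sum_ηinv_mul (μ : Fin 4) (f : Fin 4 → ℝ) :
    ∑ ν : Fin 4, ηinv μ ν * f ν = ηinv μ μ * f μ :=
  Finset.sum_eq_single μ (fun ν _ h => by simp [ηinv, h.symm]) (by simp)

theorem eps_swap_left (α β γ δ : Fin 4) : eps α β γ δ = -eps β α γ δ := by
  unfold eps; ring

theorem dualComp_eq_hodgeStar (C : FourForm) (α β γ δ : Fin 4) :
    dualComp C α β γ δ = hodgeStar (fun μ ν => comp C μ ν γ δ) α β := by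
  unfold dualComp hodgeStar
  congr 1
  refine Finset.sum_congr rfl fun μ _ => Finset.sum_congr rfl fun ν _ => ?_
  have h (ρ : Fin 4) : ∑ σ : Fin 4, eps α β μ ν * ηinv μ ρ * ηinv ν σ * comp C ρ σ γ δ =
      ηinv μ ρ * ∑ σ : Fin 4, ηinv ν σ * (eps α β μ ν * comp C ρ σ γ δ) := by
    rw [Finset.mul_sum]
    exact Finset.sum_congr rfl fun σ _ => by ring
  simp only [h, sum_ηinv_mul]
  ring

theorem hodgeStar_swap (F : Fin 4 → Fin 4 → ℝ) (α β : Fin 4) :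
    hodgeStar F α β = -hodgeStar F β α := by
  simp only [hodgeStar, eps_swap_left α β, neg_mul, Finset.sum_neg_distrib, mul_neg]

theorem hodgeStar_self (F : Fin 4 → Fin 4 → ℝ) (α : Fin 4) : hodgeStar F α α = 0 := by
  linarith [hodgeStar_swap F α α]

section Bivector

variable {F G : Fin 4 → Fin 4 → ℝ}

theorem hodgeStar_apply (hF : ∀ α β, F α β = -F β α) :
    hodgeStar F 0 1 = F 2 3 ∧ hodgeStar F 0 2 = -F 1 3 ∧ hodgeStar F 0 3 = F 1 2 ∧
      hodgeStar F 1 2 = -F 0 3 ∧ hodgeStar F 1 3 = F 0 2 ∧ hodgeStar F 2 3 = -F 0 1 := by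
  refine ⟨?_, ?_, ?_, ?_, ?_, ?_⟩ <;>
    simp [hodgeStar, Fin.sum_univ_four, eps, ηinv, hF 1 0, hF 2 0, hF 3 0, hF 2 1, hF 3 1,
      hF 3 2] <;> ring

/-- The contraction `F_{αμ} G_β^μ + *F_{αμ} *G_β^μ` is symmetric in `α, β`. -/
theorem bivector_contraction_symm (hF : ∀ α β, F α β = -F β α) (hG : ∀ α β, G α β = -G β α)
    (α β : Fin 4) :
    ∑ μ : Fin 4, ηinv μ μ * (F α μ * G β μ + hodgeStar F α μ * hodgeStar G β μ) =
      ∑ μ : Fin 4, ηinv μ μ * (F β μ * G α μ + hodgeStar F β μ * hodgeStar G α μ) := by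
  obtain ⟨f1, f2, f3, f4, f5, f6⟩ := hodgeStar_apply hF
  obtain ⟨g1, g2, g3, g4, g5, g6⟩ := hodgeStar_apply hG
  have hF' (α) : F α α = 0 := by linarith [hF α α]
  have hG' (α) : G α α = 0 := by linarith [hG α α]
  fin_cases α <;> fin_cases β <;>
    simp [Fin.sum_univ_four, ηinv, hF 1 0, hF 2 0, hF 3 0, hF 2 1, hF 3 1, hF 3 2,
      hG 1 0, hG 2 0, hG 3 0, hG 2 1, hG 3 1, hG 3 2, hF', hG', hodgeStar_self,
      hodgeStar_swap _ 1 0, hodgeStar_swap _ 2 0, hodgeStar_swap _ 3 0, hodgeStar_swap _ 2 1,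
      hodgeStar_swap _ 3 1, hodgeStar_swap _ 3 2,
      f1, f2, f3, f4, f5, f6, g1, g2, g3, g4, g5, g6] <;> ring

/-- The Hodge dual reverses the sign of the inner product of bivectors. -/
theorem bivector_contraction_trace (hF : ∀ α β, F α β = -F β α) (hG : ∀ α β, G α β = -G β α) :
    ∑ α : Fin 4, ∑ μ : Fin 4,
      ηinv α α * ηinv μ μ * (F α μ * G α μ + hodgeStar F α μ * hodgeStar G α μ) = 0 := by
  obtain ⟨f1, f2, f3, f4, f5, f6⟩ := hodgeStar_apply hF
  obtain ⟨g1, g2, g3, g4, g5, g6⟩ := hodgeStar_apply hG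
  have hF' (α) : F α α = 0 := by linarith [hF α α]
  have hG' (α) : G α α = 0 := by linarith [hG α α]
  simp [Fin.sum_univ_four, ηinv, hF 1 0, hF 2 0, hF 3 0, hF 2 1, hF 3 1, hF 3 2,
    hG 1 0, hG 2 0, hG 3 0, hG 2 1, hG 3 1, hG 3 2, hF', hG', hodgeStar_self,
    hodgeStar_swap _ 1 0, hodgeStar_swap _ 2 0, hodgeStar_swap _ 3 0, hodgeStar_swap _ 2 1,
    hodgeStar_swap _ 3 1, hodgeStar_swap _ 3 2,
    f1, f2, f3, f4, f5, f6, g1, g2, g3, g4, g5, g6]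
  ring

end Bivector

namespace IsCurvatureLike

variable {c : Fin 4 → Fin 4 → Fin 4 → Fin 4 → ℝ}

theorem antisymm_right (hc : IsCurvatureLike c) (α β γ δ : Fin 4) :
    c α β γ δ = -c α β δ γ := by
  rw [hc.pair_symm, hc.antisymm, hc.pair_symm]

theorem sub_swap (hc : IsCurvatureLike c) (α μ γ ν : Fin 4) :
    c α μ γ ν - c γ μ α ν = c α γ μ ν := by
  linarith [hc.bianchi α μ γ ν, hc.pair_symm γ μ α ν, hc.antisymm_right α ν γ μ,
    hc.antisymm_right α γ ν μ]

/-- Antisymmetrizing the quadratic contraction of a curvature-like array. -/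
theorem contraction_sub_swap (hc : IsCurvatureLike c) (α β γ δ : Fin 4) :
    ∑ μ : Fin 4, ∑ ν : Fin 4, ηinv μ μ * ηinv ν ν * (c α μ γ ν * c β μ δ ν) -
      ∑ μ : Fin 4, ∑ ν : Fin 4, ηinv μ μ * ηinv ν ν * (c γ μ α ν * c β μ δ ν) =
    (1 / 2) * ∑ μ : Fin 4, ∑ ν : Fin 4, ηinv μ μ * ηinv ν ν * (c μ ν α γ * c μ ν β δ) := by
  have h₁ : ∑ μ : Fin 4, ∑ ν : Fin 4, ηinv μ μ * ηinv ν ν * (c α γ μ ν * c β μ δ ν) =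
      -∑ μ : Fin 4, ∑ ν : Fin 4, ηinv μ μ * ηinv ν ν * (c α γ μ ν * c δ μ β ν) := by
    rw [Finset.sum_comm]
    simp only [← Finset.sum_neg_distrib]
    refine Finset.sum_congr rfl fun μ _ => Finset.sum_congr rfl fun ν _ => ?_
    rw [hc.antisymm_right α γ ν μ, hc.pair_symm β ν δ μ]
    ring
  have h₂ : ∑ μ : Fin 4, ∑ ν : Fin 4, ηinv μ μ * ηinv ν ν * (c μ ν α γ * c μ ν β δ) =
      ∑ μ : Fin 4, ∑ ν : Fin 4, ηinv μ μ * ηinv ν ν * (c α γ μ ν * c β μ δ ν) -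
        ∑ μ : Fin 4, ∑ ν : Fin 4, ηinv μ μ * ηinv ν ν * (c α γ μ ν * c δ μ β ν) := by
    simp only [← Finset.sum_sub_distrib]
    refine Finset.sum_congr rfl fun μ _ => Finset.sum_congr rfl fun ν _ => ?_
    rw [hc.pair_symm μ ν α γ, hc.pair_symm μ ν β δ, ← hc.sub_swap β μ δ ν]
    ring
  have h₃ : ∑ μ : Fin 4, ∑ ν : Fin 4, ηinv μ μ * ηinv ν ν * (c α μ γ ν * c β μ δ ν) -
      ∑ μ : Fin 4, ∑ ν : Fin 4, ηinv μ μ * ηinv ν ν * (c γ μ α ν * c β μ δ ν) =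
      ∑ μ : Fin 4, ∑ ν : Fin 4, ηinv μ μ * ηinv ν ν * (c α γ μ ν * c β μ δ ν) := by
    simp only [← Finset.sum_sub_distrib]
    refine Finset.sum_congr rfl fun μ _ => Finset.sum_congr rfl fun ν _ => ?_
    rw [← hc.sub_swap α μ γ ν]
    ring
  linarith

/-- It suffices to check the pair symmetry on increasing pairs and the first Bianchi identity
on `0, 1, 2, 3`. -/
theorem of_antisymm (hl : ∀ α β γ δ, c α β γ δ = -c β α γ δ)
    (hr : ∀ α β γ δ, c α β γ δ = -c α β δ γ)
    (hp : ∀ α β γ δ, α < β → γ < δ → c α β γ δ = c γ δ α β)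
    (hb : c 0 1 2 3 + c 0 2 3 1 + c 0 3 1 2 = 0) : IsCurvatureLike c := by
  have zl (α γ δ) : c α α γ δ = 0 := by linarith [hl α α γ δ]
  have zr (α γ δ) : c γ δ α α = 0 := by linarith [hr γ δ α α]
  have hp' (α β γ δ) : c α β γ δ = c γ δ α β := by
    rcases lt_trichotomy α β with h | rfl | h
    · rcases lt_trichotomy γ δ with h' | rfl | h'
      · exact hp _ _ _ _ h h'
      · rw [zl, zr]
      · rw [hr, hl γ, hp _ _ _ _ h h']
    · rw [zl, zr]
    · rcases lt_trichotomy γ δ with h' | rfl | h'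
      · rw [hl, hr γ, hp _ _ _ _ h h']
      · rw [zl, zr]
      · rw [hl, hr, hl γ, hr δ, hp _ _ _ _ h h']
  refine ⟨hl, hp', fun α β γ δ => ?_⟩
  by_cases h₁ : α = β
  · subst h₁
    linarith [zl α γ δ, hr α γ δ α, hp' α γ α δ]
  by_cases h₂ : α = γ
  · subst h₂
    linarith [zl α δ β, hr α δ β α, hp' α β α δ]
  by_cases h₃ : α = δ
  · subst h₃
    linarith [zl α β γ, hr α β γ α, hp' α β α γ]
  by_cases h₄ : β = γ
  · subst h₄
    linarith [zr β α δ, hr α β β δ]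
  by_cases h₅ : β = δ
  · subst h₅
    linarith [zr β α γ, hr α β β γ]
  by_cases h₆ : γ = δ
  · subst h₆
    linarith [zr γ α β, hr α γ γ β]
  have e₁ := hr 0 2 3 1
  have e₂ := hp' 0 1 2 3
  have e₃ := hp' 0 2 1 3
  have e₄ := hp' 0 3 1 2
  fin_cases α <;> fin_cases β <;> (first | exact absurd rfl h₁ | skip) <;>
    fin_cases γ <;> (first | exact absurd rfl h₂ | exact absurd rfl h₄ | skip) <;>
    fin_cases δ <;>
    first
    | exact absurd rfl h₃
    | exact absurd rfl h₅
    | exact absurd rfl h₆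
    | simp only [Fin.zero_eta, Fin.mk_one, Fin.reduceFinMk, hl 1 0, hl 2 0, hl 3 0, hl 2 1, hl 3 1,
        hl 3 2, hr _ _ 1 0, hr _ _ 2 0, hr _ _ 3 0, hr _ _ 2 1, hr _ _ 3 1, hr _ _ 3 2]
      linarith

/-- The Hodge dual of a traceless curvature-like array is curvature-like. -/
theorem hodgeStar_of_traceless (hc : IsCurvatureLike c)
    (htr : ∀ α β, ∑ μ : Fin 4, ηinv μ μ * c μ α μ β = 0) :
    IsCurvatureLike fun α β γ δ => hodgeStar (fun μ ν => c μ ν γ δ) α β := by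
  have hz (α γ δ) : c α α γ δ = 0 := by linarith [hc.antisymm α α γ δ]
  have hz' (α γ δ) : c γ δ α α = 0 := by linarith [hc.antisymm_right γ δ α α]
  have hs (γ δ) := hodgeStar_apply (F := fun μ ν => c μ ν γ δ) fun α β => hc.antisymm α β γ δ
  simp only [forall_and] at hs
  obtain ⟨s01, s02, s03, s12, s13, s23⟩ := hs
  simp only [Fin.sum_univ_four, ηinv, if_true, Fin.isValue, one_ne_zero, if_false,
    Fin.reduceEq, neg_one_mul, one_mul] at htr
  have hb := hc.bianchi 0 1 2 3
  have t00 := htr 0 0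
  have t01 := htr 0 1
  have t02 := htr 0 2
  have t03 := htr 0 3
  have t11 := htr 1 1
  have t12 := htr 1 2
  have t13 := htr 1 3
  have t22 := htr 2 2
  have t23 := htr 2 3
  have t33 := htr 3 3
  simp only [hc.antisymm 1 0, hc.antisymm 2 0, hc.antisymm 3 0,
    hc.antisymm 2 1, hc.antisymm 3 1, hc.antisymm 3 2, hc.antisymm_right _ _ 1 0,
    hc.antisymm_right _ _ 2 0, hc.antisymm_right _ _ 3 0, hc.antisymm_right _ _ 2 1,
    hc.antisymm_right _ _ 3 1, hc.antisymm_right _ _ 3 2, hz, hz']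
    at hb t00 t01 t02 t03 t11 t12 t13 t22 t23 t33
  refine of_antisymm (fun α β γ δ => hodgeStar_swap _ α β) (fun α β γ δ => ?_)
    (fun α β γ δ h h' => ?_) ?_
  · simp only [hodgeStar, hc.antisymm_right _ _ γ δ, mul_neg, Finset.sum_neg_distrib]
  · fin_cases α <;> fin_cases β <;> (first | exact absurd h (by decide) | skip) <;>
      fin_cases γ <;> fin_cases δ <;> (first | exact absurd h' (by decide) | skip) <;>
      simp only [Fin.zero_eta, Fin.mk_one, Fin.reduceFinMk, s01, s02, s03, s12, s13, s23] <;>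
      linarith [hc.pair_symm 0 1 0 2, hc.pair_symm 0 1 0 3, hc.pair_symm 0 1 1 2,
        hc.pair_symm 0 1 1 3, hc.pair_symm 0 1 2 3, hc.pair_symm 0 2 0 3, hc.pair_symm 0 2 1 2,
        hc.pair_symm 0 2 1 3, hc.pair_symm 0 2 2 3, hc.pair_symm 0 3 1 2, hc.pair_symm 0 3 1 3,
        hc.pair_symm 0 3 2 3, hc.pair_symm 1 2 1 3, hc.pair_symm 1 2 2 3, hc.pair_symm 1 3 2 3]
  · simp only [s01, s02, s03]
    linarith [hc.antisymm_right 1 3 3 1]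

end IsCurvatureLike

namespace IsWeylCandidate

variable {C : FourForm}

theorem isCurvatureLike_comp (hC : IsWeylCandidate C) : IsCurvatureLike (comp C) :=
  ⟨fun _ _ _ _ => hC.1 _ _ _ _, fun _ _ _ _ => hC.2.2.1 _ _ _ _,
    fun _ _ _ _ => hC.2.2.2.1 _ _ _ _⟩

theorem isCurvatureLike_dualComp (hC : IsWeylCandidate C) : IsCurvatureLike (dualComp C) := by
  have h := hC.isCurvatureLike_comp.hodgeStar_of_traceless fun α β => by
    simpa only [comp, sum_ηinv_mul] using hC.2.2.2.2 (stdB α) (stdB β)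
  simpa only [← dualComp_eq_hodgeStar] using h

theorem belRobinsonComp_eq (hC : IsWeylCandidate C) (α β γ δ : Fin 4) :
    belRobinsonComp C α β γ δ = ∑ μ : Fin 4, ∑ ν : Fin 4, ηinv μ μ * ηinv ν ν *
      (comp C α μ γ ν * comp C β μ δ ν + dualComp C α μ γ ν * dualComp C β μ δ ν) := by
  refine Finset.sum_congr rfl fun μ _ => Finset.sum_congr rfl fun ν _ => ?_
  simp only [mul_assoc, ← Finset.mul_sum, sum_ηinv_mul]
  rw [hC.isCurvatureLike_comp.pair_symm β, hC.isCurvatureLike_dualComp.pair_symm β]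

theorem belRobinsonComp_pair_symm (hC : IsWeylCandidate C) (α β γ δ : Fin 4) :
    belRobinsonComp C α β γ δ = belRobinsonComp C γ δ α β := by
  rw [hC.belRobinsonComp_eq, hC.belRobinsonComp_eq, Finset.sum_comm]
  refine Finset.sum_congr rfl fun μ _ => Finset.sum_congr rfl fun ν _ => ?_
  rw [hC.isCurvatureLike_comp.pair_symm α, hC.isCurvatureLike_comp.pair_symm β,
    hC.isCurvatureLike_dualComp.pair_symm α, hC.isCurvatureLike_dualComp.pair_symm β]
  ring

theorem belRobinsonComp_swap₀₁ (hC : IsWeylCandidate C) (α β γ δ : Fin 4) :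
    belRobinsonComp C α β γ δ = belRobinsonComp C β α γ δ := by
  have anti (γ δ α β : Fin 4) : comp C α β γ δ = -comp C β α γ δ :=
    hC.isCurvatureLike_comp.antisymm α β γ δ
  rw [hC.belRobinsonComp_eq, hC.belRobinsonComp_eq, Finset.sum_comm,
    Finset.sum_comm (f := fun μ ν => ηinv μ μ * ηinv ν ν *
      (comp C β μ γ ν * comp C α μ δ ν + dualComp C β μ γ ν * dualComp C α μ δ ν))]
  refine Finset.sum_congr rfl fun ν _ => ?_
  have h := bivector_contraction_symm (anti γ ν) (anti δ ν) α β
  simp only [mul_comm _ (ηinv ν ν), mul_assoc, ← Finset.mul_sum, dualComp_eq_hodgeStar]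
  rw [h]

theorem belRobinsonComp_swap₀₂ (hC : IsWeylCandidate C) (α β γ δ : Fin 4) :
    belRobinsonComp C α β γ δ = belRobinsonComp C γ β α δ := by
  have anti (γ δ α β : Fin 4) : comp C α β γ δ = -comp C β α γ δ :=
    hC.isCurvatureLike_comp.antisymm α β γ δ
  have h := bivector_contraction_trace (anti α γ) (anti β δ)
  have hc := hC.isCurvatureLike_comp.contraction_sub_swap α β γ δ
  have hd := hC.isCurvatureLike_dualComp.contraction_sub_swap α β γ δ
  simp only [← dualComp_eq_hodgeStar, mul_add, Finset.sum_add_distrib] at h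
  simp only [hC.belRobinsonComp_eq, mul_add, Finset.sum_add_distrib]
  linarith

theorem belRobinsonComp_swap₁₂ (hC : IsWeylCandidate C) (α β γ δ : Fin 4) :
    belRobinsonComp C α β γ δ = belRobinsonComp C α γ β δ := by
  rw [hC.belRobinsonComp_swap₀₂, hC.belRobinsonComp_swap₀₁, hC.belRobinsonComp_swap₀₂]

theorem belRobinsonComp_swap₂₃ (hC : IsWeylCandidate C) (α β γ δ : Fin 4) :
    belRobinsonComp C α β γ δ = belRobinsonComp C α β δ γ := by
  rw [hC.belRobinsonComp_pair_symm, hC.belRobinsonComp_swap₀₁, hC.belRobinsonComp_pair_symm]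

theorem belRobinsonComp_trace (hC : IsWeylCandidate C) (γ δ : Fin 4) :
    ∑ μ : Fin 4, ηinv μ μ * belRobinsonComp C μ μ γ δ = 0 := by
  have anti (γ δ α β : Fin 4) : comp C α β γ δ = -comp C β α γ δ :=
    hC.isCurvatureLike_comp.antisymm α β γ δ
  have h : ∑ ν : Fin 4, ηinv ν ν * ∑ α : Fin 4, ∑ μ : Fin 4, ηinv α α * ηinv μ μ *
      (comp C α μ γ ν * comp C α μ δ ν + dualComp C α μ γ ν * dualComp C α μ δ ν) = 0 := by
    simp only [dualComp_eq_hodgeStar]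
    exact Finset.sum_eq_zero fun ν _ => by
      rw [bivector_contraction_trace (anti γ ν) (anti δ ν), mul_zero]
  rw [← h]
  simp only [hC.belRobinsonComp_eq, Finset.mul_sum]
  symm
  rw [Finset.sum_comm]
  refine Finset.sum_congr rfl fun α _ => ?_
  rw [Finset.sum_comm]
  refine Finset.sum_congr rfl fun μ _ => Finset.sum_congr rfl fun ν _ => ?_
  ring

theorem belRobinson_swap₀₁ (hC : IsWeylCandidate C) (a b c d : Fin 4 → ℝ) :
    belRobinson C a b c d = belRobinson C b a c d := by
  unfold belRobinson
  rw [Finset.sum_comm]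
  refine Finset.sum_congr rfl fun β _ => Finset.sum_congr rfl fun α _ =>
    Finset.sum_congr rfl fun γ _ => Finset.sum_congr rfl fun δ _ => ?_
  rw [hC.belRobinsonComp_swap₀₁]
  ring

theorem belRobinson_swap₁₂ (hC : IsWeylCandidate C) (a b c d : Fin 4 → ℝ) :
    belRobinson C a b c d = belRobinson C a c b d := by
  refine Finset.sum_congr rfl fun α _ => ?_
  rw [Finset.sum_comm]
  refine Finset.sum_congr rfl fun β _ => Finset.sum_congr rfl fun γ _ =>
    Finset.sum_congr rfl fun δ _ => ?_
  rw [hC.belRobinsonComp_swap₁₂]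
  ring

theorem belRobinson_swap₂₃ (hC : IsWeylCandidate C) (a b c d : Fin 4 → ℝ) :
    belRobinson C a b c d = belRobinson C a b d c := by
  refine Finset.sum_congr rfl fun α _ => Finset.sum_congr rfl fun β _ => ?_
  rw [Finset.sum_comm]
  refine Finset.sum_congr rfl fun γ _ => Finset.sum_congr rfl fun δ _ => ?_
  rw [hC.belRobinsonComp_swap₂₃]
  ring

theorem belRobinson_perm (hC : IsWeylCandidate C) (σ : Equiv.Perm (Fin 4))
    (v : Fin 4 → Fin 4 → ℝ) :
    belRobinson C (v (σ 0)) (v (σ 1)) (v (σ 2)) (v (σ 3)) =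
      belRobinson C (v 0) (v 1) (v 2) (v 3) := by
  have hσ : σ ∈ Submonoid.closure
      (Set.range fun i : Fin 3 => Equiv.swap i.castSucc i.succ) := by
    rw [Equiv.Perm.mclosure_swap_castSucc_succ]
    exact Submonoid.mem_top σ
  induction hσ using Submonoid.closure_induction generalizing v with
  | mem τ hτ =>
    obtain ⟨i, rfl⟩ := hτ
    fin_cases i
    · exact hC.belRobinson_swap₀₁ _ _ _ _
    · exact hC.belRobinson_swap₁₂ _ _ _ _
    · exact hC.belRobinson_swap₂₃ _ _ _ _
  | one => rfl
  | mul τ ρ _ _ hτ hρ => exact (hρ fun i => v (τ i)).trans (hτ v)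

end IsWeylCandidate

theorem belRobinson_stdB_stdB (C : FourForm) (μ ν : Fin 4) (a b : Fin 4 → ℝ) :
    belRobinson C (stdB μ) (stdB ν) a b =
      ∑ γ : Fin 4, ∑ δ : Fin 4, a γ * b δ * belRobinsonComp C μ ν γ δ := by
  unfold belRobinson
  rw [Finset.sum_eq_single μ (fun α _ h => by simp [stdB, h]) (by simp),
    Finset.sum_eq_single ν (fun β _ h => by simp [stdB, h]) (by simp)]
  simp [stdB]

/-- The Bel–Robinson tensor of a Weyl candidate is fully symmetric in its four
arguments and every `η`-trace of it vanishes. -/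
theorem belRobinson_symmetric_and_traceless
    (C : FourForm) (hC : IsWeylCandidate C) :
    (∀ σ : Equiv.Perm (Fin 4), ∀ a b c d : Fin 4 → ℝ,
        belRobinson C a b c d =
          belRobinson C (![a, b, c, d] (σ 0)) (![a, b, c, d] (σ 1))
            (![a, b, c, d] (σ 2)) (![a, b, c, d] (σ 3))) ∧
    (∀ a b : Fin 4 → ℝ,
        ∑ μ : Fin 4, ∑ ν : Fin 4, ηinv μ ν * belRobinson C (stdB μ) (stdB ν) a b = 0) := by
  refine ⟨fun σ a b c d => (hC.belRobinson_perm σ ![a, b, c, d]).symm, fun a b => ?_⟩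
  simp only [sum_ηinv_mul]
  simp only [belRobinson_stdB_stdB, Finset.mul_sum]
  rw [Finset.sum_comm]
  refine Finset.sum_eq_zero fun γ _ => ?_
  rw [Finset.sum_comm]
  refine Finset.sum_eq_zero fun δ _ => ?_
  simp only [mul_left_comm _ (a γ * b δ), ← Finset.mul_sum, hC.belRobinsonComp_trace, mul_zero]
end

section
/- Let C be a Weyl candidate tensor on Minkowski ℝ⁴ and let T be its Bel–Robinson tensor. Then for every causal vector u (η(u,u) ≤ 0), the super-energy density W := T(u,u,u,u) is non-negative: T(u,u,u,u) ≥ 0. -/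
open Finset

/-- Contraction of both slots `1` and `3` of a component array with the vector `u`; for the Weyl
tensor and its dual this gives the electric and the magnetic part. -/
def electricPart (u : Fin 4 → ℝ) (X : Fin 4 → Fin 4 → Fin 4 → Fin 4 → ℝ) (μ ν : Fin 4) : ℝ :=
  ∑ α, ∑ γ, u α * u γ * X α μ γ ν

lemma sum_sum_sum_sum_sum_comm (f : Fin 4 → Fin 4 → Fin 4 → Fin 4 → Fin 4 → ℝ) :
    ∑ α, ∑ β, ∑ γ, ∑ δ, ∑ μ, f α β γ δ μ = ∑ μ, ∑ α, ∑ β, ∑ γ, ∑ δ, f α β γ δ μ :=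
  (sum_congr rfl fun _ _ => (sum_congr rfl fun _ _ =>
    (sum_congr rfl fun _ _ => sum_comm).trans sum_comm).trans sum_comm).trans sum_comm

lemma electricPart_mul_electricPart (u : Fin 4 → ℝ) (X : Fin 4 → Fin 4 → Fin 4 → Fin 4 → ℝ)
    (μ ν : Fin 4) :
    electricPart u X μ ν * electricPart u X ν μ =
      ∑ α, ∑ β, ∑ γ, ∑ δ, u α * u β * u γ * u δ * (X α μ γ ν * X δ ν β μ) := by
  have h : electricPart u X ν μ = ∑ β, ∑ δ, u δ * u β * X δ ν β μ := sum_comm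
  rw [h, electricPart, sum_mul_sum]
  refine sum_congr rfl fun α _ => sum_congr rfl fun β _ => ?_
  rw [sum_mul_sum]
  exact sum_congr rfl fun γ _ => sum_congr rfl fun δ _ => by ring

lemma belRobinsonComp_eq (C : FourForm) (α β γ δ : Fin 4) :
    belRobinsonComp C α β γ δ = ∑ μ, ∑ ν, ηinv μ μ * ηinv ν ν *
      (comp C α μ γ ν * comp C δ ν β μ + dualComp C α μ γ ν * dualComp C δ ν β μ) := by
  have h (μ ν : Fin 4) : ηinv μ ν = if μ = ν then ηinv μ μ else 0 := by
    by_cases hμν : μ = ν <;> simp [ηinv, hμν]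
  unfold belRobinsonComp
  refine sum_congr rfl fun μ _ => sum_congr rfl fun ν _ => ?_
  rw [sum_eq_single_of_mem μ (mem_univ μ), sum_eq_single_of_mem ν (mem_univ ν)]
  · intro ν' _ hν
    rw [h ν ν', if_neg hν.symm]
    ring
  · intro μ' _ hμ
    rw [h μ μ', if_neg hμ.symm]
    simp

/-- The super-energy density in terms of the electric and magnetic parts. -/
lemma belRobinson_self_eq (C : FourForm) (u : Fin 4 → ℝ) :
    belRobinson C u u u u =
      (∑ μ, ∑ ν, ηinv μ μ * ηinv ν ν *
        (electricPart u (comp C) μ ν * electricPart u (comp C) ν μ)) +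
      ∑ μ, ∑ ν, ηinv μ μ * ηinv ν ν *
        (electricPart u (dualComp C) μ ν * electricPart u (dualComp C) ν μ) := by
  simp only [electricPart_mul_electricPart, belRobinson, belRobinsonComp_eq]
  rw [← sum_add_distrib]
  simp only [← sum_add_distrib, mul_sum]
  rw [sum_sum_sum_sum_sum_comm]
  refine sum_congr rfl fun μ _ => ?_
  rw [sum_sum_sum_sum_sum_comm]
  refine sum_congr rfl fun ν _ => sum_congr rfl fun α _ => sum_congr rfl fun β _ =>
    sum_congr rfl fun γ _ => sum_congr rfl fun δ _ => ?_
  ring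

lemma electricPart_symm (u : Fin 4 → ℝ) {X : Fin 4 → Fin 4 → Fin 4 → Fin 4 → ℝ}
    (hX : ∀ α β γ δ, X α β γ δ = X γ δ α β) (μ ν : Fin 4) :
    electricPart u X μ ν = electricPart u X ν μ := by
  unfold electricPart
  rw [sum_comm]
  exact sum_congr rfl fun γ _ => sum_congr rfl fun α _ => by rw [hX]; ring

lemma sum_mul_electricPart (u : Fin 4 → ℝ) {X : Fin 4 → Fin 4 → Fin 4 → Fin 4 → ℝ}
    (hX : ∀ α β γ δ, X α β γ δ = -X α β δ γ) (μ : Fin 4) :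
    ∑ ν, u ν * electricPart u X μ ν = 0 := by
  have h : ∑ ν, u ν * electricPart u X μ ν = ∑ α, ∑ γ, ∑ ν, u α * u γ * u ν * X α μ γ ν := by
    simp only [electricPart, mul_sum]
    rw [sum_comm]
    refine sum_congr rfl fun α _ => ?_
    rw [sum_comm]
    exact sum_congr rfl fun γ _ => sum_congr rfl fun ν _ => by ring
  rw [h]
  refine sum_eq_zero fun α _ => self_eq_neg.mp ?_
  conv_lhs => rw [sum_comm]
  simp only [← sum_neg_distrib]
  exact sum_congr rfl fun ν _ => sum_congr rfl fun γ _ => by rw [hX]; ring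

/-- For `|v| ≤ 1` and `E` symmetric, `tr (P E P E) ≥ 0` where `P = 1 - v vᵀ`. -/
lemma trace_projected_sq_nonneg (a b c d e f x y z : ℝ) (hv : x ^ 2 + y ^ 2 + z ^ 2 ≤ 1) :
    0 ≤ (a ^ 2 + b ^ 2 + c ^ 2 + 2 * (d ^ 2 + e ^ 2 + f ^ 2))
      - 2 * ((a * x + d * y + e * z) ^ 2 + (d * x + b * y + f * z) ^ 2
        + (e * x + f * y + c * z) ^ 2)
      + (x * (a * x + d * y + e * z) + y * (d * x + b * y + f * z)
        + z * (e * x + f * y + c * z)) ^ 2 := by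
  obtain ⟨k, hk⟩ : ∃ k : ℝ, 2 * k - k ^ 2 * (x ^ 2 + y ^ 2 + z ^ 2) = 1 := by
    have hr := Real.sq_sqrt (sub_nonneg.mpr hv)
    have hr0 := Real.sqrt_nonneg (1 - (x ^ 2 + y ^ 2 + z ^ 2))
    set r := √(1 - (x ^ 2 + y ^ 2 + z ^ 2))
    refine ⟨1 / (1 + r), ?_⟩
    have : 1 + r ≠ 0 := by positivity
    field_simp
    linear_combination -hr
  set p := a * x + d * y + e * z
  set q := d * x + b * y + f * z
  set r := e * x + f * y + c * z
  set t := x * p + y * q + z * r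
  have key : (a ^ 2 + b ^ 2 + c ^ 2 + 2 * (d ^ 2 + e ^ 2 + f ^ 2))
        - 2 * (p ^ 2 + q ^ 2 + r ^ 2) + t ^ 2 =
      (a - 2 * k * x * p + k ^ 2 * t * x ^ 2) ^ 2 + (b - 2 * k * y * q + k ^ 2 * t * y ^ 2) ^ 2
      + (c - 2 * k * z * r + k ^ 2 * t * z ^ 2) ^ 2
      + 2 * ((d - k * (x * q + y * p) + k ^ 2 * t * x * y) ^ 2
        + (e - k * (x * r + z * p) + k ^ 2 * t * x * z) ^ 2
        + (f - k * (y * r + z * q) + k ^ 2 * t * y * z) ^ 2) := by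
    linear_combination (2 * (p ^ 2 + q ^ 2 + r ^ 2)
      - t ^ 2 * (2 * k - k ^ 2 * (x ^ 2 + y ^ 2 + z ^ 2) + 1)) * hk
  rw [key]
  positivity

/-- A symmetric bilinear form annihilated by a nonzero causal vector has nonnegative Lorentzian
square norm. -/
lemma sum_ηinv_mul_sq_nonneg {u : Fin 4 → ℝ} (hu : mink u u ≤ 0) (hu0 : u 0 ≠ 0)
    {E : Fin 4 → Fin 4 → ℝ} (hE : ∀ μ ν, E μ ν = E ν μ) (hEu : ∀ μ, ∑ ν, u ν * E μ ν = 0) :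
    0 ≤ ∑ μ, ∑ ν, ηinv μ μ * ηinv ν ν * (E μ ν * E ν μ) := by
  obtain ⟨x, hx⟩ : ∃ x, u 1 = x * u 0 := ⟨u 1 / u 0, by field_simp⟩
  obtain ⟨y, hy⟩ : ∃ y, u 2 = y * u 0 := ⟨u 2 / u 0, by field_simp⟩
  obtain ⟨z, hz⟩ : ∃ z, u 3 = z * u 0 := ⟨u 3 / u 0, by field_simp⟩
  have hv : x ^ 2 + y ^ 2 + z ^ 2 ≤ 1 := by
    rw [mink, hx, hy, hz] at hu
    have : 0 < u 0 ^ 2 := by positivity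
    nlinarith
  have hE0 (μ : Fin 4) : E μ 0 = -(x * E μ 1 + y * E μ 2 + z * E μ 3) := by
    have h := hEu μ
    rw [Fin.sum_univ_four, hx, hy, hz] at h
    apply mul_left_cancel₀ hu0
    linear_combination h
  have key := trace_projected_sq_nonneg (E 1 1) (E 2 2) (E 3 3) (E 1 2) (E 1 3) (E 2 3) x y z hv
  simp only [Fin.sum_univ_four, ηinv, Fin.isValue, if_true, one_ne_zero, if_false,
    show (2 : Fin 4) ≠ 0 by decide, show (3 : Fin 4) ≠ 0 by decide]
  rw [hE0 0, hE 0 1, hE 0 2, hE 0 3, hE0 1, hE0 2, hE0 3, hE 2 1, hE 3 1, hE 3 2]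
  linarith

lemma belRobinson_self_nonneg_of_symm {C : FourForm} {u : Fin 4 → ℝ} (hu : mink u u ≤ 0)
    (hC : ∀ α β γ δ, comp C α β γ δ = -comp C α β δ γ)
    (hC' : ∀ α β γ δ, comp C α β γ δ = comp C γ δ α β)
    (hD' : ∀ α β γ δ, dualComp C α β γ δ = dualComp C γ δ α β) :
    0 ≤ belRobinson C u u u u := by
  have hD (α β γ δ : Fin 4) : dualComp C α β γ δ = -dualComp C α β δ γ := by
    simp only [dualComp, hC _ _ γ δ, mul_neg, sum_neg_distrib]
  by_cases hu0 : u 0 = 0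
  · have hu' : u = 0 := by
      rw [mink, hu0] at hu
      ext i
      fin_cases i
      · exact hu0
      all_goals
        simp only [Pi.zero_apply]
        apply pow_eq_zero_iff two_ne_zero |>.mp
        apply le_antisymm _ (sq_nonneg _)
        simp only [Fin.mk_one, Fin.reduceFinMk]
        nlinarith [sq_nonneg (u 1), sq_nonneg (u 2), sq_nonneg (u 3)]
    simp [belRobinson, hu']
  · rw [belRobinson_self_eq]
    exact add_nonneg
      (sum_ηinv_mul_sq_nonneg hu hu0 (electricPart_symm u hC') (sum_mul_electricPart u hC))
      (sum_ηinv_mul_sq_nonneg hu hu0 (electricPart_symm u hD') (sum_mul_electricPart u hD))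

lemma dualComp_swap_left (C : FourForm) (α β γ δ : Fin 4) :
    dualComp C α β γ δ = -dualComp C β α γ δ := by
  have h (μ ν : Fin 4) : eps α β μ ν = -eps β α μ ν := by unfold eps; ring
  simp only [dualComp, h, neg_mul, mul_neg, sum_neg_distrib]

lemma dualComp_eq (C : FourForm) (α β γ δ : Fin 4) :
    dualComp C α β γ δ =
      (1 / 2) * ∑ μ, ∑ ν, eps α β μ ν * ηinv μ μ * ηinv ν ν * comp C μ ν γ δ := by
  simp [dualComp, ηinv]

lemma IsWeylCandidate.dualComp_symm {C : FourForm} (hC : IsWeylCandidate C) (α β γ δ : Fin 4) :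
    dualComp C α β γ δ = dualComp C γ δ α β := by
  obtain ⟨h1, h2, h3, -, h5⟩ := hC
  have a1 (α β γ δ) : comp C α β γ δ = -comp C β α γ δ := h1 ..
  have a2 (α β γ δ) : comp C α β γ δ = -comp C α β δ γ := h2 ..
  have a3 (α β γ δ) : comp C α β γ δ = comp C γ δ α β := h3 ..
  have a5 (β δ) : -comp C 0 β 0 δ + comp C 1 β 1 δ + comp C 2 β 2 δ + comp C 3 β 3 δ = 0 := by
    have h := h5 (stdB β) (stdB δ)
    simpa [ηinv, comp, Fin.sum_univ_four] using h
  have d2 (α β γ δ) : dualComp C α β γ δ = -dualComp C α β δ γ := by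
    simp only [dualComp, a2 _ _ γ δ, mul_neg, sum_neg_distrib]
  have d01 (γ δ) : dualComp C 0 1 γ δ = comp C 2 3 γ δ := by
    rw [dualComp_eq]; simp [Fin.sum_univ_four, eps, ηinv]; linarith [a1 2 3 γ δ]
  have d02 (γ δ) : dualComp C 0 2 γ δ = -comp C 1 3 γ δ := by
    rw [dualComp_eq]; simp [Fin.sum_univ_four, eps, ηinv]; linarith [a1 1 3 γ δ]
  have d03 (γ δ) : dualComp C 0 3 γ δ = comp C 1 2 γ δ := by
    rw [dualComp_eq]; simp [Fin.sum_univ_four, eps, ηinv]; linarith [a1 1 2 γ δ]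
  have d12 (γ δ) : dualComp C 1 2 γ δ = -comp C 0 3 γ δ := by
    rw [dualComp_eq]; simp [Fin.sum_univ_four, eps, ηinv]; linarith [a1 0 3 γ δ]
  have d13 (γ δ) : dualComp C 1 3 γ δ = comp C 0 2 γ δ := by
    rw [dualComp_eq]; simp [Fin.sum_univ_four, eps, ηinv]; linarith [a1 0 2 γ δ]
  have d23 (γ δ) : dualComp C 2 3 γ δ = -comp C 0 1 γ δ := by
    rw [dualComp_eq]; simp [Fin.sum_univ_four, eps, ηinv]; linarith [a1 0 1 γ δ]
  have z1 (α γ δ) : comp C α α γ δ = 0 := self_eq_neg.mp (a1 ..)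
  have z2 (α β γ) : comp C α β γ γ = 0 := self_eq_neg.mp (a2 ..)
  have H : ∀ α β γ δ : Fin 4, α < β → γ < δ → dualComp C α β γ δ = dualComp C γ δ α β := by
    have hlt : ∀ α β : Fin 4, α < β → (α = 0 ∧ β = 1) ∨ (α = 0 ∧ β = 2) ∨ (α = 0 ∧ β = 3) ∨
        (α = 1 ∧ β = 2) ∨ (α = 1 ∧ β = 3) ∨ (α = 2 ∧ β = 3) := by decide
    have t00 := a5 0 0
    have t11 := a5 1 1
    have t22 := a5 2 2
    have t33 := a5 3 3
    have t01 := a5 0 1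
    have t02 := a5 0 2
    have t03 := a5 0 3
    have t12 := a5 1 2
    have t13 := a5 1 3
    have t23 := a5 2 3
    simp only [z1, z2, a1 1 0, a1 2 0, a1 3 0, a1 2 1, a1 3 1, a1 3 2, a2 _ _ 1 0, a2 _ _ 2 0,
      a2 _ _ 3 0, a2 _ _ 2 1, a2 _ _ 3 1, a2 _ _ 3 2] at t00 t11 t22 t33 t01 t02 t03 t12 t13 t23
    intro α β γ δ hαβ hγδ
    obtain ⟨rfl, rfl⟩ | ⟨rfl, rfl⟩ | ⟨rfl, rfl⟩ | ⟨rfl, rfl⟩ | ⟨rfl, rfl⟩ | ⟨rfl, rfl⟩ :=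
      hlt α β hαβ <;>
    obtain ⟨rfl, rfl⟩ | ⟨rfl, rfl⟩ | ⟨rfl, rfl⟩ | ⟨rfl, rfl⟩ | ⟨rfl, rfl⟩ | ⟨rfl, rfl⟩ :=
      hlt γ δ hγδ <;>
    simp only [d01, d02, d03, d12, d13, d23] <;>
    linarith [a3 0 1 0 2, a3 0 1 0 3, a3 0 1 1 2, a3 0 1 1 3, a3 0 1 2 3, a3 0 2 0 3,
      a3 0 2 1 2, a3 0 2 1 3, a3 0 2 2 3, a3 0 3 1 2, a3 0 3 1 3, a3 0 3 2 3, a3 1 2 1 3,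
      a3 1 2 2 3, a3 1 3 2 3]
  have w1 (α γ δ) : dualComp C α α γ δ = 0 := self_eq_neg.mp (dualComp_swap_left ..)
  have w2 (α β γ) : dualComp C α β γ γ = 0 := self_eq_neg.mp (d2 ..)
  have s1 := dualComp_swap_left C
  rcases lt_trichotomy α β with h | rfl | h
  · rcases lt_trichotomy γ δ with h' | rfl | h'
    · exact H _ _ _ _ h h'
    · rw [w1, w2]
    · rw [d2, s1 γ, H _ _ _ _ h h']
  · rw [w1, w2]
  · rcases lt_trichotomy γ δ with h' | rfl | h'
    · rw [s1 α, d2 γ, H _ _ _ _ h h']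
    · rw [w1, w2]
    · rw [s1 α, d2 β, s1 γ, d2 δ, H _ _ _ _ h h']

/-- For every causal vector `u`, the super-energy density `W = T(u,u,u,u)` of
the Bel–Robinson tensor of a Weyl candidate is non-negative. -/
theorem belRobinson_superEnergy_nonneg
    (C : FourForm) (hC : IsWeylCandidate C)
    (u : Fin 4 → ℝ) (hu : mink u u ≤ 0) :
    belRobinson C u u u u ≥ 0 := by
  have hS := hC.dualComp_symm
  obtain ⟨-, h2, h3, -, -⟩ := hC
  exact belRobinson_self_nonneg_of_symm hu (fun _ _ _ _ => h2 ..) (fun _ _ _ _ => h3 ..) hS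
end

section
/- Let C be a Weyl candidate tensor on Minkowski ℝ⁴ and let T be its Bel–Robinson tensor. Then T satisfies the dominant super-energy property: for any four causal future-pointing vectors u₁, u₂, u₃, u₄ (η(uᵢ,uᵢ) ≤ 0 and (uᵢ)₀ > 0 for each i), one has T(u₁,u₂,u₃,u₄) ≥ 0. [This is the dominant property of the Bel–Robinson tensor used in the paper to conclude that super-momenta built from it are causal and future-pointing.] -/
open Finset

open Matrix ComplexOrder in
/-- The trace of a product of two positive semidefinite matrices is non-negative. -/
lemma Matrix.PosSemidef.trace_mul_nonneg {n : Type*} [Fintype n]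
    {A B : Matrix n n ℂ} (hA : A.PosSemidef) (hB : B.PosSemidef) : 0 ≤ (A * B).trace := by
  obtain ⟨m, v, rfl⟩ := Matrix.posSemidef_iff_eq_sum_vecMulVec.mp hA
  rw [Finset.sum_mul, Matrix.trace_sum]
  refine Finset.sum_nonneg fun i _ => ?_
  rw [Matrix.vecMulVec_mul, Matrix.trace_vecMulVec, dotProduct_comm, ← Matrix.dotProduct_mulVec]
  exact hB.dotProduct_mulVec_nonneg (v i)

/-- The Hermitian matrix `u₀ + u⃗ · σ` of a vector in Minkowski space. -/
noncomputable def pauliMatrix (u : Fin 4 → ℝ) : Matrix (Fin 2) (Fin 2) ℂ :=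
  !![u 0 + u 3, u 1 - Complex.I * u 2; u 1 + Complex.I * u 2, u 0 - u 3]

lemma pauliMatrix_isHermitian (u : Fin 4 → ℝ) : (pauliMatrix u).IsHermitian := by
  ext i j
  fin_cases i <;> fin_cases j <;> simp [pauliMatrix, sub_eq_add_neg]

open ComplexOrder in
lemma pauliMatrix_posSemidef {u : Fin 4 → ℝ} (h : mink u u ≤ 0) (h0 : 0 < u 0) :
    (pauliMatrix u).PosSemidef := by
  have key : pauliMatrix u = (2 * u 0)⁻¹ •
      ((pauliMatrix u).conjTranspose * pauliMatrix u +
        (-mink u u) • (1 : Matrix (Fin 2) (Fin 2) ℂ)) := by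
    rw [eq_inv_smul_iff₀ (by positivity), pauliMatrix_isHermitian]
    ext i j
    fin_cases i <;> fin_cases j <;>
      simp [pauliMatrix, mink] <;> ring_nf <;> simp [Complex.I_sq]
  rw [key]
  exact ((Matrix.posSemidef_conjTranspose_mul_self _).add
    (Matrix.PosSemidef.one.smul (neg_nonneg.mpr h))).smul (by positivity)

/-- A basis of the self-dual bivectors. -/
noncomputable def selfDualBasis (i : Fin 3) : Matrix (Fin 4) (Fin 4) ℂ :=
  ![!![0, 1, 0, 0; -1, 0, 0, 0; 0, 0, 0, -Complex.I; 0, 0, Complex.I, 0],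
    !![0, 0, 1, 0; 0, 0, 0, Complex.I; -1, 0, 0, 0; 0, -Complex.I, 0, 0],
    !![0, 0, 0, 1; 0, 0, -Complex.I, 0; 0, Complex.I, 0, 0; -1, 0, 0, 0]] i

/-- The contractions of a vector with the self-dual basis bivectors. -/
noncomputable def selfDualContraction (u : Fin 4 → ℝ) : Matrix (Fin 3) (Fin 4) ℂ :=
  Matrix.of fun i μ => ∑ α, (u α : ℂ) * selfDualBasis i α μ

/-- The matrix of the components `η^{μν}`. -/
noncomputable def metricMatrix : Matrix (Fin 4) (Fin 4) ℂ := Matrix.of fun μ ν => (ηinv μ ν : ℂ)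

/-- The Hermitian form on self-dual bivectors given by the Maxwell energy-momentum tensor
evaluated on `u` and `v`. -/
noncomputable def maxwellForm (u v : Fin 4 → ℝ) : Matrix (Fin 3) (Fin 3) ℂ :=
  selfDualContraction u * metricMatrix * (selfDualContraction v).conjTranspose

lemma maxwellForm_isHermitian (u v : Fin 4 → ℝ) : (maxwellForm u v).IsHermitian := by
  ext i j
  fin_cases i <;> fin_cases j <;>
    simp [maxwellForm, selfDualContraction, metricMatrix, ηinv, selfDualBasis, Matrix.mul_apply,
      Fin.sum_univ_succ] <;> ring_nf <;> simp [Complex.I_sq] <;> ring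

/-- The matrix `conj x · σ` attached to a complex 3-vector `x`. -/
noncomputable def conjSpinor (x : Fin 3 → ℂ) : Matrix (Fin 2) (Fin 2) ℂ :=
  !![star (x 2), star (x 0) - Complex.I * star (x 1);
    star (x 0) + Complex.I * star (x 1), -star (x 2)]

open Matrix in
lemma two_mul_maxwellForm (u v : Fin 4 → ℝ) (x : Fin 3 → ℂ) :
    2 * (star x ⬝ᵥ maxwellForm u v *ᵥ x) =
      (pauliMatrix u * (conjSpinor x * pauliMatrix ![v 0, -v 1, -v 2, -v 3] *
        (conjSpinor x).conjTranspose)).trace := by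
  simp [maxwellForm, selfDualContraction, metricMatrix, ηinv, selfDualBasis, Matrix.mul_apply,
    Fin.sum_univ_succ, pauliMatrix, conjSpinor, Matrix.trace, dotProduct, mulVec,
    vecMul, conjTranspose_apply]
  ring_nf
  simp only [Complex.I_sq, Complex.I_pow_four]
  ring

open Matrix ComplexOrder in
/-- The dominant energy condition for the Maxwell energy-momentum tensor. -/
lemma maxwellForm_posSemidef {u v : Fin 4 → ℝ} (hu : mink u u ≤ 0) (hu0 : 0 < u 0)
    (hv : mink v v ≤ 0) (hv0 : 0 < v 0) : (maxwellForm u v).PosSemidef := by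
  refine Matrix.PosSemidef.of_dotProduct_mulVec_nonneg (maxwellForm_isHermitian u v) fun x => ?_
  have hv' : (pauliMatrix ![v 0, -v 1, -v 2, -v 3]).PosSemidef :=
    pauliMatrix_posSemidef (by simpa [mink] using hv) (by simpa using hv0)
  suffices h : 0 ≤ 2 * (star x ⬝ᵥ maxwellForm u v *ᵥ x) by
    simpa using mul_nonneg (show (0 : ℂ) ≤ 2⁻¹ from inv_nonneg.mpr zero_le_two) h
  rw [two_mul_maxwellForm]
  exact (pauliMatrix_posSemidef hu hu0).trace_mul_nonneg (hv'.mul_mul_conjTranspose_same _)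

open Matrix ComplexOrder in
/-- Two Maxwell forms of causal vectors pair non-negatively through any complex matrix. -/
lemma re_trace_maxwellForm_nonneg {a b c d : Fin 4 → ℝ}
    (ha : mink a a ≤ 0) (ha0 : 0 < a 0) (hb : mink b b ≤ 0) (hb0 : 0 < b 0)
    (hc : mink c c ≤ 0) (hc0 : 0 < c 0) (hd : mink d d ≤ 0) (hd0 : 0 < d 0)
    (Q : Matrix (Fin 3) (Fin 3) ℂ) :
    0 ≤ ((maxwellForm a b)ᵀ * (Q * maxwellForm c d * Qᴴ)).trace.re :=
  (Complex.nonneg_iff.mp <|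
    (maxwellForm_posSemidef ha ha0 hb hb0).transpose.trace_mul_nonneg
      ((maxwellForm_posSemidef hc hc0 hd hd0).mul_mul_conjTranspose_same Q)).1

/-- Components of the complex self-dual tensor `C + i *C`. -/
noncomputable def selfDualComp (C : FourForm) (α β γ δ : Fin 4) : ℂ :=
  comp C α β γ δ + Complex.I * dualComp C α β γ δ

/-- The components of `C + i *C` in the self-dual basis. -/
noncomputable def selfDualMatrix (C : FourForm) : Matrix (Fin 3) (Fin 3) ℂ :=
  Matrix.of fun i j => selfDualComp C 0 i.succ 0 j.succ

section WeylCandidate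

variable {C : FourForm}

lemma IsWeylCandidate.comp_swap_left (hC : IsWeylCandidate C) (α β γ δ : Fin 4) :
    comp C α β γ δ = -comp C β α γ δ := hC.1 _ _ _ _

lemma IsWeylCandidate.comp_swap_right (hC : IsWeylCandidate C) (α β γ δ : Fin 4) :
    comp C α β γ δ = -comp C α β δ γ := hC.2.1 _ _ _ _

lemma IsWeylCandidate.comp_self_left (hC : IsWeylCandidate C) (α γ δ : Fin 4) :
    comp C α α γ δ = 0 := self_eq_neg.mp (hC.comp_swap_left α α γ δ)

lemma IsWeylCandidate.comp_self_right (hC : IsWeylCandidate C) (α β γ : Fin 4) :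
    comp C α β γ γ = 0 := self_eq_neg.mp (hC.comp_swap_right α β γ γ)

lemma IsWeylCandidate.comp_swap_pairs (hC : IsWeylCandidate C) (α β γ δ : Fin 4) :
    comp C α β γ δ = comp C γ δ α β := hC.2.2.1 _ _ _ _

lemma IsWeylCandidate.comp_bianchi (hC : IsWeylCandidate C) (α β γ δ : Fin 4) :
    comp C α β γ δ + comp C α γ δ β + comp C α δ β γ = 0 := hC.2.2.2.1 _ _ _ _

lemma IsWeylCandidate.comp_trace (hC : IsWeylCandidate C) (α β : Fin 4) :
    -comp C 0 α 0 β + comp C 1 α 1 β + comp C 2 α 2 β + comp C 3 α 3 β = 0 := by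
  have h := hC.2.2.2.2 (stdB α) (stdB β)
  simp [ηinv, Fin.sum_univ_succ] at h
  simp only [comp]
  linarith

/-- The components of the left dual of a Weyl candidate. -/
lemma IsWeylCandidate.dualComp_eq (hC : IsWeylCandidate C) (α β γ δ : Fin 4) :
    dualComp C α β γ δ =
      !![0, comp C 2 3 γ δ, -comp C 1 3 γ δ, comp C 1 2 γ δ;
        -comp C 2 3 γ δ, 0, -comp C 0 3 γ δ, comp C 0 2 γ δ;
        comp C 1 3 γ δ, comp C 0 3 γ δ, 0, -comp C 0 1 γ δ;
        -comp C 1 2 γ δ, -comp C 0 2 γ δ, comp C 0 1 γ δ, 0] α β := by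
  have h := fun α β => hC.comp_swap_left α β γ δ
  fin_cases α <;> fin_cases β <;>
    simp [dualComp, Fin.sum_univ_succ, ηinv, eps, h 1 0, h 2 0, h 3 0, h 2 1, h 3 1, h 3 2] <;>
    ring

lemma IsWeylCandidate.selfDualComp_left (hC : IsWeylCandidate C) (α β γ δ : Fin 4) :
    selfDualComp C α β γ δ = ∑ i, selfDualBasis i α β * selfDualComp C 0 i.succ γ δ := by
  have h := fun α β => hC.comp_swap_left α β γ δ
  have hd := hC.comp_self_left
  fin_cases α <;> fin_cases β <;>
    simp [selfDualComp, hC.dualComp_eq, Fin.sum_univ_succ, selfDualBasis, hd,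
      h 1 0, h 2 0, h 3 0, h 2 1, h 3 1, h 3 2] <;> ring_nf <;> simp [Complex.I_sq]

/-- The spatial components of a Weyl candidate in terms of its electric components. -/
lemma IsWeylCandidate.comp_spatial (hC : IsWeylCandidate C) :
    comp C 2 3 2 3 = -comp C 0 1 0 1 ∧ comp C 1 3 1 3 = -comp C 0 2 0 2 ∧
    comp C 1 2 1 2 = -comp C 0 3 0 3 ∧ comp C 1 3 2 3 = comp C 0 1 0 2 ∧
    comp C 1 2 2 3 = -comp C 0 1 0 3 ∧ comp C 1 2 1 3 = comp C 0 2 0 3 := by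
  have hl := hC.comp_swap_left
  have hr := hC.comp_swap_right
  have hd := hC.comp_self_left
  have hd' := hC.comp_self_right
  have t00 := hC.comp_trace 0 0
  have t11 := hC.comp_trace 1 1
  have t22 := hC.comp_trace 2 2
  have t33 := hC.comp_trace 3 3
  have t12 := hC.comp_trace 1 2
  have t13 := hC.comp_trace 1 3
  have t23 := hC.comp_trace 2 3
  simp only [hd, hd', hl 1 0, hl 2 0, hl 3 0, hl 2 1, hl 3 1, hl 3 2, hr _ _ 1 0, hr _ _ 2 0,
    hr _ _ 3 0, hr _ _ 2 1, hr _ _ 3 1, hr _ _ 3 2] at t00 t11 t22 t33 t12 t13 t23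
  refine ⟨?_, ?_, ?_, ?_, ?_, ?_⟩ <;> linarith

/-- The linear relations between the magnetic components of a Weyl candidate. -/
lemma IsWeylCandidate.comp_magnetic (hC : IsWeylCandidate C) :
    comp C 0 2 1 2 = -comp C 0 3 1 3 ∧ comp C 0 3 2 3 = comp C 0 1 1 2 ∧
    comp C 0 2 2 3 = -comp C 0 1 1 3 ∧
    comp C 0 1 2 3 - comp C 0 2 1 3 + comp C 0 3 1 2 = 0 := by
  have hl := hC.comp_swap_left
  have hr := hC.comp_swap_right
  have hd := hC.comp_self_left
  have hd' := hC.comp_self_right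
  have t01 := hC.comp_trace 0 1
  have t02 := hC.comp_trace 0 2
  have t03 := hC.comp_trace 0 3
  have hb := hC.comp_bianchi 0 1 2 3
  simp only [hd, hd', hl 1 0, hl 2 0, hl 3 0, hr _ _ 2 1, hr _ _ 3 1, hr _ _ 3 2]
    at t01 t02 t03 hb
  refine ⟨?_, ?_, ?_, ?_⟩ <;> linarith

/-- The right dual of a Weyl candidate agrees with its left dual. -/
lemma IsWeylCandidate.selfDualComp_right (hC : IsWeylCandidate C) (i : Fin 3) (γ δ : Fin 4) :
    selfDualComp C 0 i.succ γ δ = ∑ j, selfDualBasis j γ δ * selfDualMatrix C i j := by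
  have hr := hC.comp_swap_right
  have hd := hC.comp_self_right
  have hp := hC.comp_swap_pairs
  obtain ⟨s1, s2, s3, s4, s5, s6⟩ := hC.comp_spatial
  obtain ⟨m1, m2, m3, m4⟩ := hC.comp_magnetic
  fin_cases i <;> fin_cases γ <;> fin_cases δ <;>
    simp [selfDualComp, selfDualMatrix, hC.dualComp_eq, Fin.sum_univ_succ, selfDualBasis, hd,
      hr _ _ 1 0, hr _ _ 2 0, hr _ _ 3 0, hr _ _ 2 1, hr _ _ 3 1, hr _ _ 3 2, hp 0 2 0 1,
      hp 0 3 0 1, hp 1 2 0 1, hp 1 3 0 1, hp 2 3 0 1, hp 0 3 0 2, hp 1 2 0 2, hp 1 3 0 2,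
      hp 2 3 0 2, hp 1 2 0 3, hp 1 3 0 3, hp 2 3 0 3, hp 1 3 1 2, hp 2 3 1 2, hp 2 3 1 3,
      Complex.ext_iff] <;>
    first | done | (constructor <;> linarith) | linarith

lemma IsWeylCandidate.selfDualMatrix_transpose (hC : IsWeylCandidate C) :
    (selfDualMatrix C).transpose = selfDualMatrix C := by
  have hp := hC.comp_swap_pairs
  obtain ⟨m1, m2, m3, -⟩ := hC.comp_magnetic
  ext i j
  fin_cases i <;> fin_cases j <;>
    simp [selfDualMatrix, selfDualComp, hC.dualComp_eq, hp 0 2 0 1, hp 0 3 0 1,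
      hp 1 2 0 1, hp 1 3 0 1, hp 2 3 0 1, hp 0 3 0 2, hp 1 2 0 2, hp 1 3 0 2, hp 2 3 0 2,
      hp 1 2 0 3, hp 1 3 0 3, hp 2 3 0 3, m1, m2, m3]

lemma IsWeylCandidate.selfDualComp_eq (hC : IsWeylCandidate C) (α β γ δ : Fin 4) :
    selfDualComp C α β γ δ =
      ∑ i, ∑ j, selfDualBasis i α β * selfDualBasis j γ δ * selfDualMatrix C i j := by
  rw [hC.selfDualComp_left]
  simp only [hC.selfDualComp_right, Finset.mul_sum, mul_assoc]

end WeylCandidate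

/-- Contraction of `C + i *C` with vectors in the first and third slots. -/
lemma IsWeylCandidate.sum_selfDualComp {C : FourForm} (hC : IsWeylCandidate C)
    (u v : Fin 4 → ℝ) (μ ν : Fin 4) :
    ∑ α, ∑ γ, (u α : ℂ) * v γ * selfDualComp C α μ γ ν =
      ((selfDualContraction u).transpose * selfDualMatrix C * selfDualContraction v) μ ν := by
  simp only [hC.selfDualComp_eq, Matrix.mul_apply, Matrix.transpose_apply, selfDualContraction,
    Matrix.of_apply, Finset.mul_sum, Finset.sum_mul]
  simp only [← Fintype.sum_prod_type']
  refine Fintype.sum_equiv ⟨fun (α, γ, i, j) => (j, γ, i, α), fun (j, γ, i, α) => (α, γ, i, j),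
    fun _ => rfl, fun _ => rfl⟩ _ _ fun _ => ?_
  simp only [Equiv.coe_fn_mk]
  ring

lemma belRobinsonComp_eq_re (C : FourForm) (α β γ δ : Fin 4) :
    belRobinsonComp C α β γ δ = (∑ μ, ∑ ν, ∑ μ', ∑ ν', metricMatrix μ μ' * metricMatrix ν ν' *
      (selfDualComp C α μ γ ν * star (selfDualComp C δ ν' β μ'))).re := by
  simp only [belRobinsonComp, Complex.re_sum, metricMatrix, Matrix.of_apply]
  simp [selfDualComp]

lemma belRobinson_eq_re_sum (C : FourForm) (a b c d : Fin 4 → ℝ) :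
    belRobinson C a b c d = (∑ μ, ∑ μ', ∑ ν', ∑ ν,
      (∑ α, ∑ γ, (a α : ℂ) * c γ * selfDualComp C α μ γ ν) * metricMatrix ν ν' *
      star (∑ δ, ∑ β, (d δ : ℂ) * b β * selfDualComp C δ ν' β μ') * metricMatrix μ μ').re := by
  have h : ∀ α β γ δ (z : ℂ),
      a α * b β * c γ * d δ * z.re = ((a α : ℂ) * b β * c γ * d δ * z).re := by
    intro α β γ δ z
    rw [← Complex.re_ofReal_mul]
    push_cast
    rfl
  simp only [belRobinson, belRobinsonComp_eq_re, h, ← Complex.re_sum]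
  congr 1
  simp only [star_sum, Finset.mul_sum, Finset.sum_mul]
  simp only [← Fintype.sum_prod_type']
  refine Fintype.sum_equiv ⟨fun (α, β, γ, δ, μ, ν, μ', ν') => (μ, μ', ν', ν, δ, β, α, γ),
    fun (μ, μ', ν', ν, δ, β, α, γ) => (α, β, γ, δ, μ, ν, μ', ν'),
    fun _ => rfl, fun _ => rfl⟩ _ _ fun _ => ?_
  simp only [Equiv.coe_fn_mk, star_mul', Complex.star_def, Complex.conj_ofReal]
  ring

open Matrix in
/-- The Bel–Robinson tensor as the trace of a product of Maxwell forms. -/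
lemma IsWeylCandidate.belRobinson_eq_re_trace {C : FourForm} (hC : IsWeylCandidate C)
    (a b c d : Fin 4 → ℝ) :
    belRobinson C a b c d = ((maxwellForm a b)ᵀ *
      (selfDualMatrix C * maxwellForm c d * (selfDualMatrix C)ᴴ)).trace.re := by
  have hQ : (selfDualMatrix C)ᴴᵀ = (selfDualMatrix C)ᴴ := by
    have h : (selfDualMatrix C)ᵀᴴᵀ = (selfDualMatrix C)ᴴ := rfl
    rwa [hC.selfDualMatrix_transpose] at h
  have hd : (selfDualContraction d)ᵀᴴᵀ = (selfDualContraction d)ᴴ := rfl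
  have h : ((maxwellForm a b)ᵀ *
      (selfDualMatrix C * maxwellForm c d * (selfDualMatrix C)ᴴ)).trace =
      ((selfDualContraction a)ᵀ * selfDualMatrix C * selfDualContraction c * metricMatrix *
        ((selfDualContraction d)ᵀ * selfDualMatrix C * selfDualContraction b)ᴴᵀ *
        metricMatrixᵀ).trace := by
    simp only [maxwellForm, transpose_mul, conjTranspose_mul, hQ, hd, Matrix.mul_assoc]
    rw [trace_mul_comm]
    simp only [Matrix.mul_assoc]
    rw [trace_mul_comm]
    simp only [Matrix.mul_assoc]
  rw [belRobinson_eq_re_sum, h]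
  simp only [hC.sum_selfDualComp]
  simp only [trace, diag_apply, Matrix.mul_apply (N := metricMatrixᵀ),
    Matrix.mul_apply (N := (_)ᴴᵀ), Matrix.mul_apply (N := metricMatrix),
    transpose_apply (M := metricMatrix), transpose_apply (M := (_)ᴴ), conjTranspose_apply,
    Finset.sum_mul]

/-- Dominant super-energy property: the Bel–Robinson tensor of a Weyl candidate
is non-negative on any four causal future-pointing vectors. -/
theorem belRobinson_dominant_property
    (C : FourForm) (hC : IsWeylCandidate C)
    (u₁ u₂ u₃ u₄ : Fin 4 → ℝ)
    (h₁ : mink u₁ u₁ ≤ 0) (h₁' : u₁ 0 > 0)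
    (h₂ : mink u₂ u₂ ≤ 0) (h₂' : u₂ 0 > 0)
    (h₃ : mink u₃ u₃ ≤ 0) (h₃' : u₃ 0 > 0)
    (h₄ : mink u₄ u₄ ≤ 0) (h₄' : u₄ 0 > 0) :
    belRobinson C u₁ u₂ u₃ u₄ ≥ 0 := by
  rw [hC.belRobinson_eq_re_trace]
  exact re_trace_maxwellForm_nonneg h₁ h₁' h₂ h₂' h₃ h₃' h₄ h₄' _
end
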